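/- If n is odd or p ≠ 2, then R(n,p) ⊆ (Y_2 ∩ T) + Y_3. -/

import Mathlib

open scoped Classical

set_option synthInstance.maxHeartbeats 1000000
set_option maxHeartbeats 1000000

noncomputable section

/-- The group algebra `F_p[S_n]`. -/
abbrev GroupAlg (n p : ℕ) : Type := MonoidAlgebra (ZMod p) (Equiv.Perm (Fin n))

/-- The descent set of a permutation `σ` of `{1,…,n}` (1-based positions):
`k ∈ {1,…,n-1}` is a descent if `σ(k) > σ(k+1)`.  (With 0-based `Fin n` indices this
compares the images at indices `k-1` and `k`.) -/
def descSet {n : ℕ} (σ : Equiv.Perm (Fin n)) : Set ℕ :=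
  {k | ∃ h : k < n, 0 < k ∧ σ ⟨k, h⟩ < σ ⟨k - 1, by omega⟩}

/-- The set of proper partial sums `{a_1, a_1+a_2, …, a_1+⋯+a_{s-1}}` of a composition. -/
def properPartialSums {n : ℕ} (q : Composition n) : Set ℕ :=
  {m | ∃ i : ℕ, 0 < i ∧ i < q.length ∧ m = q.sizeUpTo i}

/-- `B̄_q`: the sum of all permutations whose descent set is contained in the set of
proper partial sums of `q`. -/
def Bel (n p : ℕ) (q : Composition n) : GroupAlg n p :=
  ∑ σ ∈ Finset.univ.filter
      (fun σ : Equiv.Perm (Fin n) => descSet σ ⊆ properPartialSums q),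
    MonoidAlgebra.of (ZMod p) (Equiv.Perm (Fin n)) σ

/-- The p-modular descent algebra `Σ(n,p)`, as a subalgebra of the group algebra. -/
def descentAlgebra (n p : ℕ) : Subalgebra (ZMod p) (GroupAlg n p) :=
  Algebra.adjoin (ZMod p) (Set.range (Bel n p))

/-- `B̄_q` as an element of `Σ(n,p)`. -/
def BelS (n p : ℕ) (q : Composition n) : descentAlgebra n p :=
  ⟨Bel n p q, Algebra.subset_adjoin ⟨q, rfl⟩⟩

/-- The Jacobson radical `R(n,p)` of `Σ(n,p)`. -/
def descentRadical (n p : ℕ) : Ideal (descentAlgebra n p) :=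
  (⊥ : Ideal (descentAlgebra n p)).jacobson

/-- `R(n,p)` viewed as an `F_p`-subspace of the group algebra. -/
def descentRadicalSubmodule (n p : ℕ) : Submodule (ZMod p) (GroupAlg n p) :=
  Submodule.map (descentAlgebra n p).val.toLinearMap
    ((descentRadical n p).restrictScalars (ZMod p))

/-- `Y_m`: the span of the `B̄_q` with `q` having at least `m` components. -/
def Ysub (n p m : ℕ) : Submodule (ZMod p) (GroupAlg n p) :=
  Submodule.span (ZMod p) {x | ∃ q : Composition n, m ≤ q.length ∧ x = Bel n p q}

/-- `T`: the span of all differences `B̄_q - B̄_r` with `q ≈ r`. -/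
def Tsub (n p : ℕ) : Submodule (ZMod p) (GroupAlg n p) :=
  Submodule.span (ZMod p)
    {x | ∃ q r : Composition n, q.blocks.Perm r.blocks ∧ x = Bel n p q - Bel n p r}

/-- `g(n,p)`: the number of partitions of `n` with no part divisible by `p`. -/
def gPart (n p : ℕ) : ℕ := Set.ncard {π : n.Partition | ∀ i ∈ π.parts, ¬ p ∣ i}

/-- `g(n,p)`: the number of conjugacy classes of `p`-regular elements of `S_n`. -/
def gReg (n p : ℕ) : ℕ :=
  Set.ncard {c : ConjClasses (Equiv.Perm (Fin n)) | ∀ σ ∈ c.carrier, (orderOf σ).Coprime p}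

/-- The Young character `χ_q`: `χ_q(σ)` is the number of ordered set partitions
`(P_1,…,P_s)` of `{1,…,n}` with `|P_i| = a_i`, each of whose blocks is `σ`-invariant. -/
def youngChar {n : ℕ} (q : Composition n) (σ : Equiv.Perm (Fin n)) : ℕ :=
  (Finset.univ.filter (fun P : Fin q.length → Finset (Fin n) =>
    (∀ i, (P i).card = q.blocksFun i) ∧
    (∀ i j, i ≠ j → Disjoint (P i) (P j)) ∧
    (∀ x, ∃ i, x ∈ P i) ∧
    (∀ i, ∀ x ∈ P i, σ x ∈ P i))).card

/-- `χ̃_q`: the Young character with values reduced mod `p`. -/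
def youngCharMod (n p : ℕ) (q : Composition n) : Equiv.Perm (Fin n) → ZMod p :=
  fun σ => (youngChar q σ : ZMod p)

/-- `G(n,p)`: the span of the mod-`p` Young characters. -/
def Gnp (n p : ℕ) : Submodule (ZMod p) (Equiv.Perm (Fin n) → ZMod p) :=
  Submodule.span (ZMod p) (Set.range (youngCharMod n p))

/-- `S(q,r)`: matrices with row sums `q` and column sums `r`. -/
def SMat {n : ℕ} (q r : Composition n) : Set (Matrix (Fin q.length) (Fin r.length) ℕ) :=
  {Z | (∀ i, ∑ j, Z i j = q.blocksFun i) ∧ (∀ j, ∑ i, Z i j = r.blocksFun j)}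

/-- `w(Z)`: the list of nonzero entries of `Z` read row by row. -/
def wList {s t : ℕ} (Z : Matrix (Fin s) (Fin t) ℕ) : List ℕ :=
  ((List.finRange s).flatMap fun i => ((List.finRange t).map fun j => Z i j)).filter
    (fun x => x ≠ 0)

/-- One merging step: replace two adjacent components by their sum. -/
def mergeStep (l l' : List ℕ) : Prop :=
  ∃ (u v : List ℕ) (a b : ℕ), l = u ++ a :: b :: v ∧ l' = u ++ (a + b) :: v

/-- `coarsens l l'` (`l ⪯ l'` on compositions): `l'` is obtained from `l` by repeatedly
replacing adjacent components by their sum. -/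
def coarsens (l l' : List ℕ) : Prop := Relation.ReflTransGen mergeStep l l'

/-- An ordered set partition of `Fin n`, encoded as the total preorder comparing the positions
of blocks. -/
@[ext]
structure SetComposition (n : ℕ) where
  le : Fin n → Fin n → Prop
  total : ∀ i j, le i j ∨ le j i
  trans : ∀ {i j k}, le i j → le j k → le i k

namespace SetComposition

variable {n : ℕ}

lemma refl (P : SetComposition n) (i : Fin n) : P.le i i := (P.total i i).elim id id

lemma le_injective : Function.Injective (le : SetComposition n → Fin n → Fin n → Prop) :=
  fun _ _ => SetComposition.ext

instance : Finite (SetComposition n) := Finite.of_injective _ le_injective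

instance : Fintype (SetComposition n) := Fintype.ofFinite _

/-- The product refines the blocks of the first factor according to the second one. -/
instance : Monoid (SetComposition n) where
  mul P Q :=
    { le := fun i j => P.le i j ∧ (P.le j i → Q.le i j)
      total := fun i j => by
        have := P.total i j
        have := Q.total i j
        tauto
      trans := fun {i j k} h h' =>
        ⟨P.trans h.1 h'.1, fun h'' => Q.trans (h.2 (P.trans h'.1 h'')) (h'.2 (P.trans h'' h.1))⟩ }
  one := ⟨fun _ _ => True, fun _ _ => Or.inl trivial, fun _ _ => trivial⟩
  mul_assoc P Q R := by
    ext i j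
    change ((P.le i j ∧ (P.le j i → Q.le i j)) ∧
        ((P.le j i ∧ (P.le i j → Q.le j i)) → R.le i j)) ↔
      (P.le i j ∧ (P.le j i → (Q.le i j ∧ (Q.le j i → R.le i j))))
    tauto
  one_mul P := by
    ext i j
    change (True ∧ (True → P.le i j)) ↔ P.le i j
    tauto
  mul_one P := by
    ext i j
    change (P.le i j ∧ (P.le j i → True)) ↔ P.le i j
    tauto

lemma mul_le (P Q : SetComposition n) (i j : Fin n) :
    (P * Q).le i j ↔ P.le i j ∧ (P.le j i → Q.le i j) := Iff.rfl

/-- The action of a permutation on ordered set partitions by relabelling the points. -/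
def relabel (σ : Equiv.Perm (Fin n)) : SetComposition n →* SetComposition n where
  toFun P := ⟨fun i j => P.le (σ.symm i) (σ.symm j), fun _ _ => P.total _ _, fun h => P.trans h⟩
  map_one' := rfl
  map_mul' _ _ := rfl

lemma relabel_le (σ : Equiv.Perm (Fin n)) (P : SetComposition n) (i j : Fin n) :
    (relabel σ P).le i j ↔ P.le (σ.symm i) (σ.symm j) := Iff.rfl

lemma relabel_symm_relabel (σ : Equiv.Perm (Fin n)) (P : SetComposition n) :
    relabel σ.symm (relabel σ P) = P := by
  ext i j
  simp [relabel_le]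

lemma relabel_relabel_symm (σ : Equiv.Perm (Fin n)) (P : SetComposition n) :
    relabel σ (relabel σ.symm P) = P := by
  ext i j
  simp [relabel_le]

lemma relabel_injective (σ : Equiv.Perm (Fin n)) : Function.Injective (relabel σ) :=
  Function.LeftInverse.injective (relabel_symm_relabel σ)

/-- The ordered set partition into singletons listed as `σ 0, σ 1, …`. -/
def chamber (σ : Equiv.Perm (Fin n)) : SetComposition n :=
  ⟨fun i j => σ.symm i ≤ σ.symm j, fun _ _ => le_total _ _, fun h h' => h.trans h'⟩

lemma chamber_le (σ : Equiv.Perm (Fin n)) (i j : Fin n) :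
    (chamber σ).le i j ↔ σ.symm i ≤ σ.symm j := Iff.rfl

lemma relabel_chamber (σ τ : Equiv.Perm (Fin n)) : relabel σ (chamber τ) = chamber (σ * τ) := rfl

/-- The number of points in strictly earlier blocks. -/
def rank (P : SetComposition n) (i : Fin n) : ℕ := (Finset.univ.filter fun j => ¬ P.le i j).card

lemma rank_le_rank_iff (P : SetComposition n) (i j : Fin n) :
    P.rank i ≤ P.rank j ↔ P.le i j := by
  constructor
  · contrapose!
    intro h
    refine Finset.card_lt_card (Finset.ssubset_iff_of_subset ?_ |>.2 ⟨j, ?_, ?_⟩)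
    · intro k
      simp only [Finset.mem_filter, Finset.mem_univ, true_and]
      exact fun hk hik => hk (P.trans ((P.total i j).resolve_left h) hik)
    · simpa using h
    · simpa using P.refl j
  · intro h
    refine Finset.card_le_card fun k => ?_
    simp only [Finset.mem_filter, Finset.mem_univ, true_and]
    exact fun hk hjk => hk (P.trans h hjk)

lemma rank_lt (P : SetComposition n) (i : Fin n) : P.rank i < n := by
  have : P.rank i < (Finset.univ : Finset (Fin n)).card :=
    Finset.card_lt_card (Finset.filter_ssubset.2 ⟨i, Finset.mem_univ _, by simpa using P.refl i⟩)
  simpa using this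

lemma rank_relabel (σ : Equiv.Perm (Fin n)) (P : SetComposition n) (i : Fin n) :
    (relabel σ P).rank i = P.rank (σ.symm i) :=
  Finset.card_bij (fun j _ => σ.symm j) (by simp [relabel_le]) (by simp)
    fun j hj => ⟨σ j, by simpa [relabel_le] using hj, by simp⟩

lemma exists_chamber (P : SetComposition n) (h : ∀ i j, P.le i j → P.le j i → i = j) :
    ∃ σ, P = chamber σ := by
  have hinj : Function.Injective fun i => (⟨P.rank i, P.rank_lt i⟩ : Fin n) := by
    intro i j hij
    have hr : P.rank i = P.rank j := congrArg Fin.val hij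
    exact h i j ((P.rank_le_rank_iff i j).1 hr.le) ((P.rank_le_rank_iff j i).1 hr.ge)
  refine ⟨(Equiv.ofBijective _ (Finite.injective_iff_bijective.1 hinj)).symm, ?_⟩
  ext i j
  rw [chamber_le, Equiv.symm_symm, ← P.rank_le_rank_iff]
  rfl

lemma chamber_injective : Function.Injective (chamber (n := n)) := by
  intro σ τ h
  have hle : ∀ a b, a ≤ b ↔ τ.symm (σ a) ≤ τ.symm (σ b) := fun a b => by
    simpa [chamber_le] using
      iff_of_eq (congrArg (fun P : SetComposition n => P.le (σ a) (σ b)) h)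
  let e : Fin n ≃o Fin n := ⟨σ.trans τ.symm, fun {a b} => (hle a b).symm⟩
  have he : e = OrderIso.refl _ := Subsingleton.elim _ _
  ext a
  have : τ.symm (σ a) = a := congrArg (fun f : Fin n ≃o Fin n => f a) he
  rw [Equiv.symm_apply_eq] at this
  rw [this]

/-- The proper partial sums of the sequence of block sizes. -/
def type (P : SetComposition n) : Finset ℕ := (Finset.univ.image P.rank).erase 0

lemma type_subset (P : SetComposition n) : P.type ⊆ Finset.Ioo 0 n := by
  intro k hk
  simp only [type, Finset.mem_erase, Finset.mem_image, Finset.mem_univ, true_and] at hk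
  obtain ⟨h0, i, rfl⟩ := hk
  exact Finset.mem_Ioo.2 ⟨Nat.pos_of_ne_zero h0, P.rank_lt i⟩

lemma type_relabel (σ : Equiv.Perm (Fin n)) (P : SetComposition n) :
    (relabel σ P).type = P.type := by
  unfold type
  congr 1
  ext k
  simp only [Finset.mem_image, Finset.mem_univ, true_and, rank_relabel]
  exact (σ.symm.surjective.exists (p := fun a => P.rank a = k)).symm

/-- The ordered set partition into the consecutive intervals starting at `0` and at the elements
of `S`. -/
def ofSet (S : Finset ℕ) : SetComposition n where
  le i j := ∀ s ∈ S, s ≤ (i : ℕ) → s ≤ (j : ℕ)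
  total i j := (le_total i j).imp (fun h _ _ hs => hs.trans h) (fun h _ _ hs => hs.trans h)
  trans h h' s hs hi := h' s hs (h s hs hi)

lemma ofSet_le (S : Finset ℕ) (i j : Fin n) :
    (ofSet S).le i j ↔ ∀ s ∈ S, s ≤ (i : ℕ) → s ≤ (j : ℕ) := Iff.rfl

lemma lt_rank_iff (P : SetComposition n) (hP : ∀ i j, i ≤ j → P.le i j) (i k : Fin n) :
    (k : ℕ) < P.rank i ↔ ¬ P.le i k := by
  constructor
  · intro h hik
    refine h.not_ge ?_
    calc P.rank i ≤ (Finset.Iio k).card := by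
          refine Finset.card_le_card fun j hj => ?_
          simp only [Finset.mem_filter, Finset.mem_univ, true_and] at hj
          rw [Finset.mem_Iio]
          exact not_le.1 fun hkj => hj (P.trans hik (hP _ _ hkj))
      _ = k := by simp
  · intro h
    calc (k : ℕ) < (Finset.Iic k).card := by simp
      _ ≤ P.rank i := by
          refine Finset.card_le_card fun j hj => ?_
          rw [Finset.mem_Iic] at hj
          simp only [Finset.mem_filter, Finset.mem_univ, true_and]
          exact fun hij => h (P.trans hij (hP _ _ hj))

lemma eq_ofSet_type (P : SetComposition n) (hP : ∀ i j, i ≤ j → P.le i j) :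
    P = ofSet P.type := by
  ext i j
  rw [ofSet_le]
  constructor
  · intro h s hs hsi
    simp only [type, Finset.mem_erase, Finset.mem_image, Finset.mem_univ, true_and] at hs
    obtain ⟨-, m, rfl⟩ := hs
    have hmi := not_not.1 ((P.lt_rank_iff hP m i).not.1 hsi.not_gt)
    exact not_lt.1 ((P.lt_rank_iff hP m j).not.2 (not_not.2 (P.trans hmi h)))
  · intro h
    by_contra hij
    have hlt := (P.lt_rank_iff hP i j).2 hij
    have hmem : P.rank i ∈ P.type := by
      simp only [type, Finset.mem_erase, Finset.mem_image, Finset.mem_univ, true_and]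
      exact ⟨by omega, i, rfl⟩
    have hri : P.rank i ≤ i := not_lt.1 ((P.lt_rank_iff hP i i).not.2 (not_not.2 (P.refl i)))
    exact hlt.not_ge (h _ hmem hri)

lemma ofSet_le_of_le (S : Finset ℕ) (i j : Fin n) (h : i ≤ j) : (ofSet S).le i j :=
  fun _ _ hs => hs.trans h

lemma type_ofSet {S : Finset ℕ} (hS : S ⊆ Finset.Ioo 0 n) :
    (ofSet S : SetComposition n).type = S := by
  have key : ∀ i k : Fin n, (k : ℕ) < (ofSet S : SetComposition n).rank i ↔
      ∃ s ∈ S, s ≤ (i : ℕ) ∧ (k : ℕ) < s := by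
    intro i k
    rw [lt_rank_iff _ (ofSet_le_of_le S), ofSet_le]
    push Not
    rfl
  ext s
  simp only [type, Finset.mem_erase, Finset.mem_image, Finset.mem_univ, true_and]
  constructor
  · rintro ⟨h0, i, rfl⟩
    have hr := (ofSet S : SetComposition n).rank_lt i
    generalize hrank : (ofSet S : SetComposition n).rank i = r at *
    obtain ⟨s, hs, hsi, hrs⟩ := (key i ⟨r - 1, by omega⟩).1 (by simp only; omega)
    have h0n := Finset.mem_Ioo.1 (hS hs)
    have := (key i ⟨s - 1, by omega⟩).2 ⟨s, hs, hsi, by simp only; omega⟩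
    simp only [hrank] at this hrs
    have : r = s := by omega
    exact this ▸ hs
  · intro hs
    have h0n := Finset.mem_Ioo.1 (hS hs)
    refine ⟨by omega, ⟨s, h0n.2⟩, ?_⟩
    have hr := (ofSet S : SetComposition n).rank_lt ⟨s, h0n.2⟩
    apply le_antisymm
    · by_contra! hlt
      obtain ⟨s', -, h1, h2⟩ := (key ⟨s, h0n.2⟩ ⟨s, h0n.2⟩).1 hlt
      exact h2.not_ge h1
    · by_contra! hlt
      exact lt_irrefl _ ((key ⟨s, h0n.2⟩ ⟨_, hr⟩).2 ⟨s, hs, le_rfl, hlt⟩)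

lemma exists_relabel_ofSet (P : SetComposition n) :
    ∃ σ : Equiv.Perm (Fin n), P * chamber 1 = chamber σ ∧ P = relabel σ (ofSet P.type) ∧
      descSet σ ⊆ ↑P.type := by
  obtain ⟨σ, hσ⟩ := (P * chamber 1).exists_chamber fun i j h h' =>
    le_antisymm (h.2 h'.1) (h'.2 h.1)
  have key : ∀ a b : Fin n, a ≤ b ↔ P.le (σ a) (σ b) ∧ (P.le (σ b) (σ a) → σ a ≤ σ b) := by
    intro a b
    have := congrArg (fun P : SetComposition n => P.le (σ a) (σ b)) hσ
    simp only [chamber_le, Equiv.symm_apply_apply] at this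
    rw [← this]
    rfl
  have hQ : relabel σ.symm P = ofSet P.type := by
    have := (relabel σ.symm P).eq_ofSet_type fun i j hij => ((key i j).1 hij).1
    rwa [type_relabel] at this
  refine ⟨σ, hσ, by rw [← hQ, relabel_relabel_symm], ?_⟩
  rintro k ⟨hk, hk0, hlt⟩
  have hnot : ¬ (ofSet P.type).le (⟨k, hk⟩ : Fin n) ⟨k - 1, by omega⟩ := by
    rw [← hQ]
    intro hle
    have := (key ⟨k, hk⟩ ⟨k - 1, by omega⟩).2 ⟨hle, fun _ => hlt.le⟩
    rw [Fin.mk_le_mk] at this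
    omega
  rw [ofSet_le] at hnot
  push Not at hnot
  obtain ⟨s, hs, h1, h2⟩ := hnot
  simp only at h1 h2
  have : s = k := by omega
  exact this ▸ hs

lemma le_of_forall_notMem_descSet (σ : Equiv.Perm (Fin n)) (a d : ℕ) (h : a + d < n)
    (hd : ∀ k, a < k → k ≤ a + d → k ∉ descSet σ) :
    σ ⟨a, by omega⟩ ≤ σ ⟨a + d, h⟩ := by
  induction d with
  | zero => exact le_rfl
  | succ d ih =>
    refine (ih (by omega) fun k h1 h2 => hd k h1 (by omega)).trans ?_
    by_contra! hlt
    exact hd (a + (d + 1)) (by omega) le_rfl ⟨h, by omega, hlt⟩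

lemma relabel_ofSet_mul_chamber {S : Finset ℕ} {σ : Equiv.Perm (Fin n)} (h : descSet σ ⊆ ↑S) :
    relabel σ (ofSet S) * chamber 1 = chamber σ := by
  have key : ∀ a b : Fin n, a ≤ b → (ofSet S).le b a → σ a ≤ σ b := by
    intro a b hab hba
    obtain ⟨d, hd⟩ := Nat.exists_eq_add_of_le hab
    have hb := b.2
    have := le_of_forall_notMem_descSet σ a d (by omega) fun k h1 h2 hk => by
      have := hba k (h hk) (by omega)
      omega
    convert this
  ext i j
  obtain ⟨a, rfl⟩ := σ.surjective i
  obtain ⟨b, rfl⟩ := σ.surjective j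
  rw [mul_le, relabel_le, relabel_le, chamber_le, chamber_le]
  simp only [Equiv.symm_apply_apply]
  constructor
  · rintro ⟨h1, h2⟩
    by_contra! hba
    have h3 : σ a ≤ σ b := h2 (ofSet_le_of_le S b a hba.le)
    exact hba.ne' (σ.injective (le_antisymm h3 (key b a hba.le h1)))
  · exact fun hab => ⟨ofSet_le_of_le S a b hab, key a b hab⟩

/-- The reverse order on the blocks. -/
def reverse (P : SetComposition n) : SetComposition n :=
  ⟨fun i j => P.le j i, fun i j => P.total j i, fun h h' => P.trans h' h⟩

lemma exists_descSet_eq {S : Finset ℕ} (hS : S ⊆ Finset.Ioo 0 n) :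
    ∃ σ : Equiv.Perm (Fin n), descSet σ = ↑S := by
  obtain ⟨τ, hτ, -⟩ := (ofSet S).reverse.exists_relabel_ofSet (n := n)
  have key : ∀ i j : Fin n, τ.symm i ≤ τ.symm j ↔
      (ofSet S).le j i ∧ ((ofSet S).le i j → i ≤ j) := fun i j =>
    iff_of_eq (congrArg (fun P : SetComposition n => P.le i j) hτ.symm)
  refine ⟨τ.symm, ?_⟩
  ext k
  constructor
  · rintro ⟨hk, h0, hlt⟩
    by_contra hkS
    refine hlt.not_ge ((key _ _).2 ⟨?_, fun _ => ?_⟩)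
    · intro s hs hsk
      simp only at hsk ⊢
      have : s ≠ k := fun h => hkS (h ▸ hs)
      omega
    · rw [Fin.mk_le_mk]
      omega
  · intro hk
    have h0n := Finset.mem_Ioo.1 (hS hk)
    refine ⟨h0n.2, h0n.1, not_le.1 fun hle => ?_⟩
    have := ((key _ _).1 hle).1 k hk le_rfl
    simp only at this
    omega

end SetComposition


/-- The sum of all permutations whose descent set is contained in `S`. -/
def subsetSum (n p : ℕ) (S : Finset ℕ) : GroupAlg n p :=
  ∑ σ ∈ Finset.univ.filter (fun σ : Equiv.Perm (Fin n) => descSet σ ⊆ ↑S),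
    MonoidAlgebra.of (ZMod p) (Equiv.Perm (Fin n)) σ

lemma bel_eq_subsetSum {n p : ℕ} {q : Composition n} {S : Finset ℕ}
    (h : properPartialSums q = ↑S) : Bel n p q = subsetSum n p S := by
  rw [Bel, h, subsetSum]

lemma mem_Ioo_of_mem_properPartialSums {n : ℕ} {q : Composition n} {k : ℕ}
    (hk : k ∈ properPartialSums q) : k ∈ Finset.Ioo 0 n := by
  obtain ⟨i, h0, hi, rfl⟩ := hk
  have hpos := q.sizeUpTo_strict_mono (h0.trans hi)
  have hlt := q.sizeUpTo_strict_mono hi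
  have h1 : q.sizeUpTo 1 ≤ q.sizeUpTo i := q.monotone_sizeUpTo h0
  have h2 : q.sizeUpTo (i + 1) ≤ n := q.sizeUpTo_le _
  rw [zero_add, q.sizeUpTo_zero] at hpos
  exact Finset.mem_Ioo.2 ⟨hpos.trans_le h1, hlt.trans_le h2⟩

lemma coeff_subsetSum (n p : ℕ) (S : Finset ℕ) (σ : Equiv.Perm (Fin n)) :
    (subsetSum n p S).coeff σ = if descSet σ ⊆ ↑S then 1 else 0 := by
  simp [subsetSum, MonoidAlgebra.coeff_sum, Finsupp.finsetSum_apply, MonoidAlgebra.of_apply,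
    MonoidAlgebra.coeff_single, Finsupp.single_apply, Finset.sum_ite_eq']

lemma eq_zero_of_sum_smul_subsetSum_eq_zero {n p : ℕ} {c : Finset ℕ → ZMod p}
    (h : ∑ S ∈ (Finset.Ioo 0 n).powerset, c S • subsetSum n p S = 0) {S : Finset ℕ}
    (hS : S ⊆ Finset.Ioo 0 n) : c S = 0 := by
  by_contra hc
  obtain ⟨M, hM, hmax⟩ := ((Finset.Ioo 0 n).powerset.filter (c · ≠ 0)).exists_max_image
    Finset.card ⟨S, by simp [hS, hc]⟩
  rw [Finset.mem_filter] at hM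
  obtain ⟨σ, hσ⟩ := SetComposition.exists_descSet_eq (Finset.mem_powerset.1 hM.1)
  have hcoeff := congrArg (fun x : GroupAlg n p => x.coeff σ) h
  simp only [MonoidAlgebra.coeff_sum, Finsupp.finsetSum_apply, MonoidAlgebra.coeff_smul,
    Finsupp.smul_apply, coeff_subsetSum, hσ, Finset.coe_subset] at hcoeff
  rw [Finset.sum_eq_single_of_mem M hM.1] at hcoeff
  · exact hM.2 (by simpa using hcoeff)
  · intro S' hS' hne
    split_ifs with hsub
    · have : c S' = 0 := by
        by_contra hc'
        exact hne (Finset.eq_of_subset_of_card_le hsub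
          (hmax S' (Finset.mem_filter.2 ⟨hS', hc'⟩))).symm
      rw [this, zero_smul]
    · exact smul_zero _

/-- The algebra of ordered set partitions. -/
abbrev FaceAlg (n p : ℕ) : Type := MonoidAlgebra (ZMod p) (SetComposition n)

namespace FaceAlg

open SetComposition

variable {n p : ℕ}

/-- Relabelling of the points, extended linearly. -/
def relabelHom (σ : Equiv.Perm (Fin n)) : FaceAlg n p →ₐ[ZMod p] FaceAlg n p :=
  MonoidAlgebra.mapDomainAlgHom (ZMod p) (ZMod p) (relabel σ)

lemma relabelHom_single (σ : Equiv.Perm (Fin n)) (P : SetComposition n) (r : ZMod p) :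
    relabelHom σ (MonoidAlgebra.single P r) = MonoidAlgebra.single (relabel σ P) r := by
  simp [relabelHom]

/-- The sum of all ordered set partitions of type `S`. -/
def orbitSum (n p : ℕ) (S : Finset ℕ) : FaceAlg n p :=
  ∑ P ∈ Finset.univ.filter (fun P : SetComposition n => P.type = S), MonoidAlgebra.single P 1

lemma relabelHom_orbitSum (σ : Equiv.Perm (Fin n)) (S : Finset ℕ) :
    relabelHom σ (orbitSum n p S) = orbitSum n p S := by
  rw [orbitSum, map_sum]
  refine Finset.sum_bij (fun P _ => relabel σ P) ?_ ?_ ?_ ?_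
  · simp [type_relabel]
  · exact fun _ _ _ _ h => relabel_injective σ h
  · intro P hP
    refine ⟨relabel σ.symm P, ?_, relabel_relabel_symm σ P⟩
    simpa [type_relabel] using hP
  · exact fun P _ => relabelHom_single σ P 1

lemma coeff_eq_coeff_ofSet {y : FaceAlg n p} (hy : ∀ σ, relabelHom σ y = y)
    (P : SetComposition n) : y.coeff P = y.coeff (ofSet P.type) := by
  obtain ⟨σ, -, hσ, -⟩ := P.exists_relabel_ofSet
  have h := congrArg (fun z : FaceAlg n p => z.coeff (relabel σ (ofSet P.type))) (hy σ)
  simp only [relabelHom, MonoidAlgebra.mapDomainAlgHom_apply, MonoidAlgebra.coeff_mapDomain] at h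
  rw [Finsupp.mapDomain_apply (relabel_injective σ), ← hσ] at h
  exact h.symm

lemma eq_sum_coeff_smul (y : FaceAlg n p) :
    y = ∑ P : SetComposition n, y.coeff P • MonoidAlgebra.single P 1 := by
  ext Q
  simp [MonoidAlgebra.coeff_sum]

lemma eq_sum_orbitSum {y : FaceAlg n p} (hy : ∀ σ, relabelHom σ y = y) :
    y = ∑ S ∈ (Finset.Ioo 0 n).powerset, y.coeff (ofSet S) • orbitSum n p S := by
  conv_lhs => rw [eq_sum_coeff_smul y, ← Finset.sum_fiberwise_of_maps_to
    (g := SetComposition.type) (fun P _ => Finset.mem_powerset.2 P.type_subset)]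
  refine Finset.sum_congr rfl fun S _ => ?_
  rw [orbitSum, Finset.smul_sum]
  refine Finset.sum_congr rfl fun P hP => ?_
  rw [coeff_eq_coeff_ofSet hy, (Finset.mem_filter.1 hP).2]

/-- The embedding of the group algebra as the span of the chambers. -/
def chamberMap (n p : ℕ) : GroupAlg n p →ₗ[ZMod p] FaceAlg n p where
  toFun := MonoidAlgebra.mapDomain chamber
  map_add' := MonoidAlgebra.mapDomain_add chamber
  map_smul' r x := MonoidAlgebra.mapDomain_smul chamber r x

lemma chamberMap_single (σ : Equiv.Perm (Fin n)) (r : ZMod p) :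
    chamberMap n p (MonoidAlgebra.single σ r) = MonoidAlgebra.single (chamber σ) r :=
  MonoidAlgebra.mapDomain_single

lemma chamberMap_injective : Function.Injective (chamberMap n p) :=
  MonoidAlgebra.mapDomain_injective chamber_injective

lemma relabelHom_chamberMap (σ : Equiv.Perm (Fin n)) (v : GroupAlg n p) :
    relabelHom σ (chamberMap n p v) = chamberMap n p (MonoidAlgebra.single σ 1 * v) := by
  induction v using MonoidAlgebra.induction_linear with
  | zero => simp
  | add x y hx hy => rw [map_add, map_add, hx, hy, mul_add, map_add]
  | single τ r =>
    rw [MonoidAlgebra.single_mul_single, chamberMap_single, chamberMap_single, relabelHom_single,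
      relabel_chamber, one_mul]

lemma orbitSum_mul_chamber {S : Finset ℕ} (hS : S ⊆ Finset.Ioo 0 n) :
    orbitSum n p S * MonoidAlgebra.single (chamber 1) 1 = chamberMap n p (subsetSum n p S) := by
  rw [orbitSum, subsetSum, Finset.sum_mul, map_sum]
  symm
  refine Finset.sum_bij (fun σ _ => relabel σ (ofSet S)) ?_ ?_ ?_ ?_
  · intro σ _
    simp [type_relabel, type_ofSet hS]
  · intro σ hσ τ hτ h
    apply chamber_injective
    rw [← relabel_ofSet_mul_chamber (Finset.mem_filter.1 hσ).2, h,
      relabel_ofSet_mul_chamber (Finset.mem_filter.1 hτ).2]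
  · intro P hP
    obtain ⟨σ, -, hσ, hd⟩ := P.exists_relabel_ofSet
    rw [(Finset.mem_filter.1 hP).2] at hσ hd
    exact ⟨σ, by simpa using hd, hσ.symm⟩
  · intro σ hσ
    rw [MonoidAlgebra.of_apply, chamberMap_single, MonoidAlgebra.single_mul_single,
      relabel_ofSet_mul_chamber (Finset.mem_filter.1 hσ).2, one_mul]

/-- `y` is invariant under relabelling and acts on chambers as right multiplication by `x`. -/
structure Represents (y : FaceAlg n p) (x : GroupAlg n p) : Prop where
  invariant : ∀ σ, relabelHom σ y = y
  mul_chamberMap : ∀ v, y * chamberMap n p v = chamberMap n p (v * x)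

lemma Represents.add {y y' : FaceAlg n p} {x x' : GroupAlg n p} (h : Represents y x)
    (h' : Represents y' x') : Represents (y + y') (x + x') where
  invariant σ := by rw [map_add, h.invariant, h'.invariant]
  mul_chamberMap v := by
    rw [add_mul, h.mul_chamberMap, h'.mul_chamberMap, mul_add, map_add]

lemma Represents.mul {y y' : FaceAlg n p} {x x' : GroupAlg n p} (h : Represents y x)
    (h' : Represents y' x') : Represents (y' * y) (x * x') where
  invariant σ := by rw [map_mul, h.invariant, h'.invariant]
  mul_chamberMap v := by
    rw [mul_assoc, h.mul_chamberMap, h'.mul_chamberMap, mul_assoc]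

lemma represents_algebraMap (r : ZMod p) :
    Represents (algebraMap (ZMod p) (FaceAlg n p) r) (algebraMap (ZMod p) (GroupAlg n p) r) where
  invariant σ := AlgHom.commutes _ r
  mul_chamberMap v := by
    rw [← Algebra.smul_def, ← Algebra.commutes, ← Algebra.smul_def, map_smul]

lemma represents_subsetSum {S : Finset ℕ} (hS : S ⊆ Finset.Ioo 0 n) :
    Represents (orbitSum n p S) (subsetSum n p S) where
  invariant σ := relabelHom_orbitSum σ S
  mul_chamberMap v := by
    induction v using MonoidAlgebra.induction_linear with
    | zero => simp
    | add x y hx hy => rw [map_add, mul_add, hx, hy, add_mul, map_add]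
    | single τ r =>
      have hsingle : (MonoidAlgebra.single τ r : GroupAlg n p) = r • MonoidAlgebra.single τ 1 := by
        simp [MonoidAlgebra.smul_single]
      rw [hsingle, map_smul, mul_smul_comm, smul_mul_assoc, map_smul, ← relabelHom_chamberMap,
        ← orbitSum_mul_chamber hS, map_mul, relabelHom_orbitSum, relabelHom_single,
        relabel_chamber, chamberMap_single, mul_one]

lemma Represents.eq_sum_subsetSum {y : FaceAlg n p} {x : GroupAlg n p} (h : Represents y x) :
    x = ∑ S ∈ (Finset.Ioo 0 n).powerset, y.coeff (ofSet S) • subsetSum n p S := by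
  apply chamberMap_injective
  have h1 := h.mul_chamberMap 1
  rw [one_mul, MonoidAlgebra.one_def, chamberMap_single] at h1
  rw [← h1]
  conv_lhs => rw [eq_sum_orbitSum h.invariant]
  rw [Finset.sum_mul, map_sum]
  refine Finset.sum_congr rfl fun S hS => ?_
  rw [smul_mul_assoc, orbitSum_mul_chamber (Finset.mem_powerset.1 hS), map_smul]

lemma Represents.unique {y y' : FaceAlg n p} {x : GroupAlg n p} (h : Represents y x)
    (h' : Represents y' x) : y = y' := by
  have hsub := h.eq_sum_subsetSum.symm.trans h'.eq_sum_subsetSum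
  rw [← sub_eq_zero, ← Finset.sum_sub_distrib] at hsub
  simp_rw [← sub_smul] at hsub
  rw [eq_sum_orbitSum h.invariant, eq_sum_orbitSum h'.invariant]
  refine Finset.sum_congr rfl fun S hS => ?_
  rw [sub_eq_zero.1 (eq_zero_of_sum_smul_subsetSum_eq_zero
    (c := fun S => y.coeff (ofSet S) - y'.coeff (ofSet S)) hsub (Finset.mem_powerset.1 hS))]

lemma exists_represents {x : GroupAlg n p} (hx : x ∈ descentAlgebra n p) :
    ∃ y, Represents y x := by
  induction hx using Algebra.adjoin_induction with
  | mem x hx =>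
    obtain ⟨q, rfl⟩ := hx
    have hq : properPartialSums q =
        ↑((Finset.Ioo 0 n).filter (· ∈ properPartialSums q)) := by
      ext k
      simpa using fun hk => Finset.mem_Ioo.1 (mem_Ioo_of_mem_properPartialSums hk)
    rw [bel_eq_subsetSum hq]
    exact ⟨_, represents_subsetSum (Finset.filter_subset _ _)⟩
  | algebraMap r => exact ⟨_, represents_algebraMap r⟩
  | add x x' _ _ h h' =>
    obtain ⟨y, hy⟩ := h
    obtain ⟨y', hy'⟩ := h'
    exact ⟨_, hy.add hy'⟩
  | mul x x' _ _ h h' =>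
    obtain ⟨y, hy⟩ := h
    obtain ⟨y', hy'⟩ := h'
    exact ⟨_, hy.mul hy'⟩

/-- Algebra homomorphisms to the prime field kill representatives of radical elements. -/
lemma Represents.algHom_eq_zero [Fact p.Prime] {x : GroupAlg n p}
    (hx : x ∈ descentRadicalSubmodule n p) {y : FaceAlg n p} (h : Represents y x)
    (f : FaceAlg n p →ₐ[ZMod p] ZMod p) : f y = 0 := by
  by_contra hne
  obtain ⟨x, hx, rfl⟩ := hx
  obtain ⟨z, hz⟩ := Ideal.mem_jacobson_iff.1 hx (algebraMap _ _ (-(f y)⁻¹))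
  have hz' : (z : GroupAlg n p) * algebraMap (ZMod p) (GroupAlg n p) (-(f y)⁻¹) * x + z = 1 := by
    have := sub_eq_zero.1 (Ideal.mem_bot.1 hz)
    exact congrArg Subtype.val this
  obtain ⟨w, hw⟩ := exists_represents z.2
  have h1 := (((hw.mul (represents_algebraMap (-(f y)⁻¹))).mul h).add hw)
  have h2 : Represents (algebraMap (ZMod p) (FaceAlg n p) 1) (algebraMap (ZMod p) (GroupAlg n p) 1) :=
    represents_algebraMap 1
  rw [map_one, map_one, ← hz'] at h2
  have h3 := congrArg f (h1.unique h2)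
  simp only [map_add, map_mul, AlgHom.commutes, Algebra.algebraMap_self, RingHom.id_apply,
    map_one] at h3
  rw [← mul_assoc, mul_neg, mul_inv_cancel₀ hne] at h3
  simp at h3

/-- The character of the monoid of ordered set partitions selecting those whose blocks are unions
of classes of `E`. -/
def character (p : ℕ) (E : Setoid (Fin n)) : SetComposition n →* ZMod p where
  toFun P := if ∀ i j, E i j → P.le i j then 1 else 0
  map_one' := if_pos fun _ _ _ => trivial
  map_mul' P Q := by
    have key : (∀ i j, E i j → (P * Q).le i j) ↔
        (∀ i j, E i j → P.le i j) ∧ ∀ i j, E i j → Q.le i j := by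
      refine ⟨fun h => ?_, fun h i j hij => ?_⟩
      · exact ⟨fun i j hij => (h i j hij).1,
          fun i j hij => (h i j hij).2 (h j i (E.symm hij)).1⟩
      · exact ⟨h.1 i j hij, fun _ => h.2 i j hij⟩
    simp only [key, ite_and, mul_ite, mul_one, mul_zero]
    split_ifs <;> rfl

lemma lift_character (E : Setoid (Fin n)) (y : FaceAlg n p) :
    MonoidAlgebra.lift (ZMod p) (ZMod p) (SetComposition n) (character p E) y =
      ∑ P ∈ Finset.univ.filter (fun P : SetComposition n => ∀ i j, E i j → P.le i j),
        y.coeff P := by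
  conv_lhs => rw [eq_sum_coeff_smul y]
  simp [character, Finset.sum_filter]

lemma coeff_ofSet_empty_eq_zero [Fact p.Prime] {x : GroupAlg n p}
    (hx : x ∈ descentRadicalSubmodule n p) {y : FaceAlg n p} (h : Represents y x) :
    y.coeff (ofSet ∅) = 0 := by
  have h0 := h.algHom_eq_zero hx (MonoidAlgebra.lift _ _ _ (character p ⊤))
  rw [lift_character, Finset.sum_eq_single_of_mem (ofSet ∅)] at h0
  · exact h0
  · simp [ofSet_le]
  · intro P hP hne
    refine absurd ?_ hne
    ext i j
    simpa [ofSet_le] using (Finset.mem_filter.1 hP).2 i j trivial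

lemma type_reverse_ofSet_singleton {a : ℕ} (ha : a ∈ Finset.Ioo 0 n) :
    (ofSet {a} : SetComposition n).reverse.type = {n - a} := by
  rw [Finset.mem_Ioo] at ha
  have hrank : ∀ i : Fin n, (ofSet {a} : SetComposition n).reverse.rank i =
      if a ≤ (i : ℕ) then 0 else n - a := by
    intro i
    have hle : ∀ j, (ofSet {a} : SetComposition n).reverse.le i j ↔
        (a ≤ (j : ℕ) → a ≤ (i : ℕ)) := fun j => by
      change (ofSet {a}).le j i ↔ _
      simp [ofSet_le]
    simp only [rank, hle]
    split_ifs with hai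
    · simp [hai]
    · have : (Finset.univ.filter fun j : Fin n => ¬ (a ≤ (j : ℕ) → a ≤ (i : ℕ))) =
          Finset.Ici ⟨a, ha.2⟩ := by
        ext j
        simp [hai, Fin.le_def]
      rw [this, Fin.card_Ici]
  ext k
  simp only [type, Finset.mem_erase, Finset.mem_image, Finset.mem_univ, true_and, hrank,
    Finset.mem_singleton]
  constructor
  · rintro ⟨h0, i, rfl⟩
    split_ifs at h0 ⊢
    · exact absurd rfl h0
    · rfl
  · rintro rfl
    exact ⟨by omega, ⟨0, by omega⟩, if_neg (by simp only; omega)⟩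

lemma coeff_ofSet_singleton_add_eq_zero [Fact p.Prime] {x : GroupAlg n p}
    (hx : x ∈ descentRadicalSubmodule n p) {y : FaceAlg n p} (h : Represents y x) {a : ℕ}
    (ha : a ∈ Finset.Ioo 0 n) :
    y.coeff (ofSet {a}) + y.coeff (ofSet {n - a}) = 0 := by
  have han := Finset.mem_Ioo.1 ha
  let E : Setoid (Fin n) := Setoid.ker fun i => a ≤ (i : ℕ)
  have hE : ∀ i j, E i j ↔ ((a ≤ (i : ℕ)) ↔ (a ≤ (j : ℕ))) := fun i j => by
    simp [E, Setoid.ker_def]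
  have h0 := h.algHom_eq_zero hx (MonoidAlgebra.lift _ _ _ (character p E))
  have hempty : ∀ i j : Fin n, (ofSet ∅).le i j := by simp [ofSet_le]
  have hsing : ∀ i j : Fin n, (ofSet {a}).le i j ↔ (a ≤ (i : ℕ) → a ≤ (j : ℕ)) := by
    simp [ofSet_le]
  have hrev : ∀ i j : Fin n, (ofSet {a}).reverse.le i j ↔ (a ≤ (j : ℕ) → a ≤ (i : ℕ)) :=
    fun i j => hsing j i
  let b : Fin n := ⟨0, by omega⟩
  let t : Fin n := ⟨a, han.2⟩
  have hb : ¬ a ≤ (b : ℕ) := by simp only [b]; omega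
  have ht : a ≤ (t : ℕ) := le_rfl
  have hset : (Finset.univ.filter fun P : SetComposition n => ∀ i j, E i j → P.le i j) =
      {ofSet ∅, ofSet {a}, (ofSet {a}).reverse} := by
    ext P
    simp only [Finset.mem_filter, Finset.mem_univ, true_and, Finset.mem_insert,
      Finset.mem_singleton, hE]
    constructor
    · intro hP
      have hPle : ∀ i j, P.le i j ↔ P.le (if a ≤ (i : ℕ) then t else b)
          (if a ≤ (j : ℕ) then t else b) := by
        have hto : ∀ i : Fin n, P.le i (if a ≤ (i : ℕ) then t else b) ∧
            P.le (if a ≤ (i : ℕ) then t else b) i := by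
          intro i
          split_ifs with hi
          · exact ⟨hP _ _ (by tauto), hP _ _ (by tauto)⟩
          · exact ⟨hP _ _ (by tauto), hP _ _ (by tauto)⟩
        exact fun i j => ⟨fun hij => P.trans (hto i).2 (P.trans hij (hto j).1),
          fun hij => P.trans (hto i).1 (P.trans hij (hto j).2)⟩
      have hbb := P.refl b
      have htt := P.refl t
      by_cases htb : P.le t b
      · by_cases hbt : P.le b t
        · left
          ext i j
          rw [hPle]
          clear hPle
          split_ifs <;> simp [*]
        · right; right
          ext i j
          rw [hPle, hrev]
          clear hPle
          split_ifs <;> simp [*]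
      · have hbt := (P.total t b).resolve_left htb
        right; left
        ext i j
        rw [hPle, hsing]
        clear hPle
        split_ifs <;> simp [*]
    · rintro (rfl | rfl | rfl) i j hij
      · exact hempty i j
      · exact (hsing i j).2 hij.1
      · exact (hrev i j).2 hij.2
  have hne1 : (ofSet ∅ : SetComposition n) ∉ ({ofSet {a}, (ofSet {a}).reverse} : Finset _) := by
    simp only [Finset.mem_insert, Finset.mem_singleton, not_or]
    exact ⟨fun h => hb ((hsing t b).1 (h ▸ hempty t b) ht),
      fun h => hb ((hrev b t).1 (h ▸ hempty b t) ht)⟩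
  have hne2 : (ofSet {a} : SetComposition n) ≠ (ofSet {a}).reverse := fun h =>
    hb ((hrev b t).1 (h ▸ (hsing b t).2 fun h => absurd h hb) ht)
  rw [lift_character, hset, Finset.sum_insert hne1, Finset.sum_pair hne2,
    coeff_ofSet_empty_eq_zero hx h, zero_add, coeff_eq_coeff_ofSet h.invariant (reverse _),
    type_reverse_ofSet_singleton ha] at h0
  exact h0

end FaceAlg


lemma exists_composition_properPartialSums_eq {n : ℕ} (hn : 1 ≤ n) {S : Finset ℕ}
    (hS : S ⊆ Finset.Ioo 0 n) :
    ∃ q : Composition n, properPartialSums q = ↑S ∧ q.length = S.card + 1 := by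
  let c : CompositionAsSet n :=
    { boundaries := Finset.univ.filter fun k : Fin n.succ => (k : ℕ) ∈ insert 0 (insert n S)
      zero_mem := by simp
      getLast_mem := by simp }
  have hcard : c.boundaries.card = S.card + 2 := by
    have h0 : 0 ∉ insert n S := by
      intro h
      rcases Finset.mem_insert.1 h with h | h
      · omega
      · simpa using hS h
    have hn' : n ∉ S := fun h => by simpa using hS h
    rw [← Finset.card_map Fin.valEmbedding, ← Nat.add_assoc S.card 1 1,
      ← Finset.card_insert_of_notMem hn', ← Finset.card_insert_of_notMem h0]
    congr 1
    ext k
    simp only [c, Finset.mem_map, Finset.mem_filter, Finset.mem_univ, true_and,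
      Fin.valEmbedding_apply]
    refine ⟨fun ⟨a, ha, hak⟩ => hak ▸ ha, fun hk => ⟨⟨k, ?_⟩, hk, rfl⟩⟩
    rcases Finset.mem_insert.1 hk with rfl | hk'
    · omega
    · rcases Finset.mem_insert.1 hk' with rfl | hk'
      · omega
      · have := Finset.mem_Ioo.1 (hS hk')
        omega
  have hlen : c.toComposition.length = S.card + 1 := by
    have := c.toComposition.card_boundaries_eq_succ_length
    rw [c.toComposition_boundaries, hcard] at this
    omega
  refine ⟨c.toComposition, ?_, hlen⟩
  have hmem : ∀ k : ℕ, (∃ i ≤ c.toComposition.length, c.toComposition.sizeUpTo i = k) ↔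
      k = 0 ∨ k = n ∨ k ∈ S := by
    intro k
    constructor
    · rintro ⟨i, hi, rfl⟩
      have : c.toComposition.boundary ⟨i, by omega⟩ ∈ c.toComposition.boundaries :=
        Finset.mem_map_of_mem _ (Finset.mem_univ _)
      rw [c.toComposition_boundaries] at this
      simpa [c, Composition.boundary] using this
    · intro hk
      have hkn : k < n + 1 := by
        rcases hk with rfl | rfl | hk
        · omega
        · omega
        · have := Finset.mem_Ioo.1 (hS hk)
          omega
      have : (⟨k, hkn⟩ : Fin n.succ) ∈ c.toComposition.boundaries := by
        rw [c.toComposition_boundaries]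
        simpa [c] using hk
      obtain ⟨i, -, hi⟩ := Finset.mem_map.1 this
      exact ⟨i, by omega, congrArg Fin.val hi⟩
  ext k
  constructor
  · intro hk
    have hkn := Finset.mem_Ioo.1 (mem_Ioo_of_mem_properPartialSums hk)
    obtain ⟨i, h0, hi, rfl⟩ := hk
    rcases (hmem _).1 ⟨i, hi.le, rfl⟩ with h | h | h
    · omega
    · omega
    · exact h
  · intro hk
    have hkn := Finset.mem_Ioo.1 (hS hk)
    obtain ⟨i, hi, rfl⟩ := (hmem k).2 (Or.inr (Or.inr hk))
    refine ⟨i, Nat.pos_of_ne_zero ?_, lt_of_le_of_ne hi ?_, rfl⟩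
    · rintro rfl
      rw [Composition.sizeUpTo_zero] at hkn
      exact hkn.1.ne rfl
    · rintro rfl
      rw [Composition.sizeUpTo_length] at hkn
      exact hkn.2.ne rfl

lemma subsetSum_mem_Ysub {n p : ℕ} (hn : 1 ≤ n) {S : Finset ℕ} (hS : S ⊆ Finset.Ioo 0 n) {m : ℕ}
    (hm : m ≤ S.card + 1) : subsetSum n p S ∈ Ysub n p m := by
  obtain ⟨q, hq, hlen⟩ := exists_composition_properPartialSums_eq hn hS
  exact Submodule.subset_span ⟨q, hlen ▸ hm, (bel_eq_subsetSum hq).symm⟩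

/-- The composition of `n` into the two parts `a` and `n - a`. -/
def pairComposition {n a : ℕ} (ha : a ∈ Finset.Ioo 0 n) : Composition n where
  blocks := [a, n - a]
  blocks_pos := by
    have := Finset.mem_Ioo.1 ha
    simp only [List.mem_cons, List.not_mem_nil, or_false]
    omega
  blocks_sum := by
    have := Finset.mem_Ioo.1 ha
    simp only [List.sum_cons, List.sum_nil]
    omega

lemma bel_pairComposition {n a : ℕ} (p : ℕ) (ha : a ∈ Finset.Ioo 0 n) :
    Bel n p (pairComposition ha) = subsetSum n p {a} := by
  apply bel_eq_subsetSum
  ext k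
  have hlen : (pairComposition ha).length = 2 := rfl
  have hsize : (pairComposition ha).sizeUpTo 1 = a := by
    simp [Composition.sizeUpTo, pairComposition]
  rw [Finset.coe_singleton, Set.mem_singleton_iff]
  constructor
  · rintro ⟨i, h0, hi, rfl⟩
    obtain rfl : i = 1 := by omega
    exact hsize
  · rintro rfl
    exact ⟨1, by omega, by omega, hsize.symm⟩

lemma sub_mem_Ioo {n a : ℕ} (ha : a ∈ Finset.Ioo 0 n) : n - a ∈ Finset.Ioo 0 n := by
  rw [Finset.mem_Ioo] at *
  omega

lemma subsetSum_singleton_sub_mem {n p a : ℕ} (ha : a ∈ Finset.Ioo 0 n) :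
    subsetSum n p {a} - subsetSum n p {n - a} ∈ Ysub n p 2 ⊓ Tsub n p := by
  rw [← bel_pairComposition p ha, ← bel_pairComposition p (sub_mem_Ioo ha)]
  refine ⟨sub_mem (Submodule.subset_span ⟨_, le_rfl, rfl⟩)
    (Submodule.subset_span ⟨_, le_rfl, rfl⟩), Submodule.subset_span ⟨_, _, ?_, rfl⟩⟩
  have hsub : n - (n - a) = a := Nat.sub_sub_self (Finset.mem_Ioo.1 ha).2.le
  simpa only [pairComposition, hsub] using List.Perm.swap _ _ _

lemma sum_smul_subsetSum_singleton_mem {n p : ℕ} [Fact p.Prime] (h : Odd n ∨ p ≠ 2)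
    {c : ℕ → ZMod p} (hc : ∀ a ∈ Finset.Ioo 0 n, c a + c (n - a) = 0) :
    ∑ a ∈ Finset.Ioo 0 n, c a • subsetSum n p {a} ∈ Ysub n p 2 ⊓ Tsub n p := by
  rw [← Submodule.Quotient.mk_eq_zero, ← Submodule.mkQ_apply, map_sum]
  refine Finset.sum_involution (fun a _ => n - a) ?_ ?_ (fun a ha => sub_mem_Ioo ha)
    fun a ha => Nat.sub_sub_self (Finset.mem_Ioo.1 ha).2.le
  · intro a ha
    have hmk : (Ysub n p 2 ⊓ Tsub n p).mkQ (subsetSum n p {a}) =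
        (Ysub n p 2 ⊓ Tsub n p).mkQ (subsetSum n p {n - a}) :=
      (Submodule.Quotient.eq _).2 (subsetSum_singleton_sub_mem ha)
    rw [map_smul, map_smul, hmk, ← add_smul, hc a ha, zero_smul]
  · intro a ha hne heq
    have han := Finset.mem_Ioo.1 ha
    have hp2 : p ≠ 2 := h.resolve_left fun ⟨k, hk⟩ => by omega
    have h2 : (2 : ZMod p) ≠ 0 := Ring.two_ne_zero (by rwa [ZMod.ringChar_zmod_n])
    have hca := hc a ha
    rw [heq, ← two_mul] at hca
    exact hne (by rw [(mul_eq_zero.1 hca).resolve_left h2, zero_smul, map_zero])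

/-- If `n` is odd or `p ≠ 2`, then `R(n,p) ⊆ (Y_2 ∩ T) + Y_3`. -/
theorem stmt13 (n p : ℕ) (hn : 1 ≤ n) (hp : p.Prime) (h : Odd n ∨ p ≠ 2) :
    descentRadicalSubmodule n p ≤ (Ysub n p 2 ⊓ Tsub n p) ⊔ Ysub n p 3 := by
  have : Fact p.Prime := ⟨hp⟩
  intro x hx
  obtain ⟨y, hy⟩ : ∃ y, FaceAlg.Represents y x := by
    obtain ⟨x, -, rfl⟩ := hx
    exact FaceAlg.exists_represents x.2
  have hsing := sum_smul_subsetSum_singleton_mem h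
    (c := fun a => y.coeff (SetComposition.ofSet {a}))
    fun a ha => FaceAlg.coeff_ofSet_singleton_add_eq_zero hx hy ha
  rw [hy.eq_sum_subsetSum,
    ← Finset.sum_filter_add_sum_filter_not _ (fun S : Finset ℕ => S.card ≤ 1)]
  refine add_mem (Submodule.mem_sup_left ?_) (Submodule.mem_sup_right ?_)
  · convert hsing using 1
    symm
    refine Finset.sum_of_injOn (fun a => {a}) (Finset.singleton_injective.injOn) ?_ ?_ ?_
    · intro a ha
      simpa using ha
    · intro S hS hne
      obtain ⟨hS, hcard⟩ := Finset.mem_filter.1 hS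
      rcases Finset.card_le_one_iff_subset_singleton.1 hcard with ⟨a, ha⟩
      rcases Finset.subset_singleton_iff.1 ha with rfl | rfl
      · rw [FaceAlg.coeff_ofSet_empty_eq_zero hx hy, zero_smul]
      · exact absurd ⟨a, by simpa using hS, rfl⟩ hne
    · exact fun _ _ => rfl
  · refine sum_mem fun S hS => Submodule.smul_mem _ _ (subsetSum_mem_Ysub hn ?_ ?_)
    · exact Finset.mem_powerset.1 (Finset.mem_filter.1 hS).1
    · have := (Finset.mem_filter.1 hS).2
      omega

end
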